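/- Let n ≥ 3 be odd, let g̃ : 𝔽₂^(n−1) → 𝔽₂ be bent and h̃ : 𝔽₂^(n−2) → 𝔽₂ be arbitrary. Define f : 𝔽₂^(n+1) → 𝔽₂ by f(x₁,…,x_{n+1}) = x_{n+1}·(g̃(x₁,…,x_{n−1}) + x_n) + h̃(x₁,…,x_{n−2}) + x_{n−1}. Then the linear space of f is trivial: V(f) = {0}. -/

import Mathlib

/-- The Hamming weight of a Boolean function: the number of inputs mapped to 1. -/
def wt {α : Type*} [Fintype α] (f : α → ZMod 2) : ℕ :=
  (Finset.univ.filter fun x => f x = 1).card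

/-- The derivative of a Boolean function at `a`. -/
def Dop {α : Type*} [Add α] (a : α) (f : α → ZMod 2) : α → ZMod 2 :=
  fun x => f (x + a) + f x

/-- A Boolean function on `m` variables is bent if all its nontrivial derivatives
are balanced. -/
def IsBent {m : ℕ} (f : (Fin m → ZMod 2) → ZMod 2) : Prop :=
  ∀ a : Fin m → ZMod 2, a ≠ 0 → wt (Dop a f) = 2 ^ (m - 1)

/-- A bent function has no nonzero direction in which its derivative is constant. -/
theorem IsBent.eq_zero_of_derivative_const {m : ℕ} (hm : 1 ≤ m)
    {g : (Fin m → ZMod 2) → ZMod 2} (hg : IsBent g) {a : Fin m → ZMod 2} {c : ZMod 2}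
    (h : ∀ x, g (x + a) + g x = c) : a = 0 := by
  by_contra ha
  have hw := hg a ha
  have hD : Dop a g = fun _ => c := funext h
  rw [hD, wt] at hw
  by_cases hc : c = 1
  · have hlt : 2 ^ (m - 1) < 2 ^ m := Nat.pow_lt_pow_right (by norm_num) (by omega)
    simp [hc] at hw
    omega
  · have : 0 < 2 ^ (m - 1) := by positivity
    simp [hc] at hw
    omega

theorem stmt_7 (n : ℕ) (hn : 3 ≤ n) (hodd : Odd n)
    (gt : (Fin (n - 1) → ZMod 2) → ZMod 2) (hgt : IsBent gt)
    (ht : (Fin (n - 2) → ZMod 2) → ZMod 2)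
    (f : (Fin (n + 1) → ZMod 2) → ZMod 2)
    (hf : ∀ x : Fin (n + 1) → ZMod 2,
      f x = x ⟨n, by omega⟩ *
              (gt (fun i => x ⟨i.val, by have := i.isLt; omega⟩) + x ⟨n - 1, by omega⟩)
            + ht (fun i => x ⟨i.val, by have := i.isLt; omega⟩) + x ⟨n - 2, by omega⟩) :
    {a : Fin (n + 1) → ZMod 2 | ∃ c : ZMod 2, ∀ x, f (x + a) + f x = c} = {0} := by
  ext a
  simp only [Set.mem_ofPred_eq, Set.mem_singleton_iff]
  constructor
  swap
  · rintro rfl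
    exact ⟨0, fun x => by rw [add_zero, CharTwo.add_self_eq_zero]⟩
  rintro ⟨c, hc⟩
  -- the point with first `n - 1` coordinates `z` and last two coordinates `u`, `v`
  let p (z : Fin (n - 1) → ZMod 2) (u v : ZMod 2) : Fin (n + 1) → ZMod 2 := fun i =>
    if h : i.val < n - 1 then z ⟨i, h⟩ else if i.val = n - 1 then u else v
  let b : Fin (n - 1) → ZMod 2 := fun i => a ⟨i.val, by omega⟩
  have hp (z : Fin (n - 1) → ZMod 2) (u v : ZMod 2) :
      (v + a ⟨n, by omega⟩) * (gt (z + b) + (u + a ⟨n - 1, by omega⟩)) + v * (gt z + u)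
        = c + ht (fun i => z ⟨i.val, by omega⟩ + a ⟨i.val, by omega⟩)
          + ht (fun i => z ⟨i.val, by omega⟩) + a ⟨n - 2, by omega⟩ := by
    have hn1 : p z u v ⟨n, by omega⟩ = v := by
      simp only [p]
      rw [dif_neg (by omega), if_neg (by omega)]
    have hn0 : p z u v ⟨n - 1, by omega⟩ = u := by simp [p]
    have hlt (i : ℕ) (hi : i < n - 1) : p z u v ⟨i, by omega⟩ = z ⟨i, hi⟩ := by simp [p, hi]
    have hz : (fun i : Fin (n - 1) => p z u v ⟨i.val, by omega⟩) = z :=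
      funext fun i => hlt i i.isLt
    have hzb : (fun i : Fin (n - 1) => (p z u v + a) ⟨i.val, by omega⟩) = z + b :=
      funext fun i => congrArg (· + b i) (hlt i i.isLt)
    have hw : (fun i : Fin (n - 2) => p z u v ⟨i.val, by omega⟩)
        = fun i => z ⟨i.val, by omega⟩ := funext fun i => hlt i (by omega)
    have hwa : (fun i : Fin (n - 2) => (p z u v + a) ⟨i.val, by omega⟩)
        = fun i => z ⟨i.val, by omega⟩ + a ⟨i.val, by omega⟩ :=
      funext fun i => congrArg (· + a _) (hlt i (by omega))
    have h := hc (p z u v)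
    rw [hf, hf, hz, hzb, hw, hwa] at h
    simp only [Pi.add_apply, hn1, hn0, hlt (n - 2) (by omega)] at h
    have h2 : (2 : ZMod 2) = 0 := rfl
    linear_combination h - (ht (fun i => z ⟨i.val, by omega⟩ + a ⟨i.val, by omega⟩)
      + ht (fun i => z ⟨i.val, by omega⟩) + a ⟨n - 2, by omega⟩ + z ⟨n - 2, by omega⟩) * h2
  have hlast : a ⟨n, by omega⟩ = 0 := by
    linear_combination hp 0 1 0 - hp 0 0 0
  have hder (z : Fin (n - 1) → ZMod 2) : gt (z + b) + gt z = a ⟨n - 1, by omega⟩ := by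
    have h := hp z 0 1
    have h' := hp z 0 0
    rw [hlast] at h h'
    have h2 : (2 : ZMod 2) = 0 := rfl
    linear_combination h - h' - a ⟨n - 1, by omega⟩ * h2
  have hb : b = 0 := hgt.eq_zero_of_derivative_const (by omega) hder
  have hmid : a ⟨n - 1, by omega⟩ = 0 := by
    rw [← hder 0, hb, add_zero, CharTwo.add_self_eq_zero]
  funext ⟨i, hi⟩
  obtain h | rfl | rfl : i < n - 1 ∨ i = n - 1 ∨ i = n := by omega
  · exact congrFun hb ⟨i, h⟩
  · exact hmid
  · exact hlast
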